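/- Fix integers m ≥ 1, n ≥ 2 and let i ∈ {1, …, n−1}. Then for every A ∈ Ξ^{ȷ,0}_{m|n,n}: (1) t^{(A)} B^R_{i+1/2} B^R_{i+1/2} = 0; (2) the composite C_i sending x to (x B^R_{i+1/2}) B^R_{−i−1/2} maps 𝒱^{ȷ,0}_{m|n,n} into itself, with C_i(t^{(A_λ)}) = t^{(A_{λ·s_i})} + q·t^{(A_λ)} if λ_i < λ_{i+1}, C_i(t^{(A_λ)}) = (q+q^{−1})·t^{(A_λ)} if λ_i = λ_{i+1}, and C_i(t^{(A_λ)}) = t^{(A_{λ·s_i})} + q^{−1}·t^{(A_λ)} if λ_i > λ_{i+1}, where λ·s_i interchanges λ_i and λ_{i+1}; (3) for T_i := id − q^{−1} C_i on 𝒱^{ȷ,0}_{m|n,n} one has (−q)·T_i(Λ^ȷ(v_λ)) = Λ^ȷ(σ_i(v_λ)) for every λ ∈ {−m,…,m}^n, and (T_i + q^{−2}·id)(T_i − id) = 0. -/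

import Mathlib

open scoped BigOperators Classical

noncomputable section

/-- The base field `ℚ(q)`. -/
abbrev K : Type := RatFunc ℚ

/-- The indeterminate `q`. -/
def q : K := RatFunc.X

/-- The quantum integer `[r] = (q^r - q^{-r})/(q - q^{-1})`. -/
def qint (r : ℤ) : K := (q ^ r - q ^ (-r)) / (q - q⁻¹)

/-- The quantum factorial `[r]!`. -/
def qfac : ℕ → K
  | 0 => 1
  | n+1 => qfac n * qint (n+1)

/-- The index set `𝕀_N = {-(N-1)/2, -(N-3)/2, …, (N-1)/2}` as a finite set of rationals. -/
def II (N : ℕ) : Finset ℚ := (Finset.range N).image (fun k : ℕ => (k : ℚ) - ((N : ℚ) - 1) / 2)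

theorem II_neg {N : ℕ} {a : ℚ} (h : a ∈ II N) : -a ∈ II N := by
  obtain ⟨k, hk, hv⟩ := Finset.mem_image.mp h
  rw [Finset.mem_range] at hk
  refine Finset.mem_image.mpr ⟨N - 1 - k, Finset.mem_range.mpr (by omega), ?_⟩
  have h1 : ((N - 1 - k : ℕ) : ℚ) = (N : ℚ) - 1 - (k : ℚ) := by
    have h2 : (N : ℚ) = ((N - 1 - k : ℕ) : ℚ) + (k : ℚ) + 1 := by
      exact_mod_cast congrArg (Nat.cast : ℕ → ℚ) (by omega : N = (N - 1 - k) + k + 1)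
    linarith
  rw [h1, ← hv]; ring

/-- Matrices with rational row/column labels and natural number entries. -/
abbrev Mat : Type := ℚ → ℚ → ℕ

/-- The θ-elementary matrix `E^θ_{r,c} = E_{r,c} + E_{-r,-c}`. -/
def chiM (r c : ℚ) : Mat := fun x y =>
  (if x = r ∧ y = c then 1 else 0) + (if x = -r ∧ y = -c then 1 else 0)

/-- `A + E^θ_{p,j} - E^θ_{p',j'}` (truncated ℕ-subtraction; only used where the
corresponding q-integer coefficient vanishes otherwise). -/
def matMove (A : Mat) (p j p' j' : ℚ) : Mat := fun x y => A x y + chiM p j x y - chiM p' j' x y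

/-- Free `ℚ(q)`-vector space on the set of matrices `P`. -/
abbrev FM (P : Set Mat) : Type := {A : Mat // A ∈ P} →₀ K

/-- Basis vector `t^{(A)}` (zero if `A ∉ P`). -/
def tP (P : Set Mat) (A : Mat) : FM P := if h : A ∈ P then Finsupp.single ⟨A, h⟩ 1 else 0

/-- Linear operator on `FM P` defined by its values on basis vectors. -/
def opOf {P : Set Mat} (f : Mat → FM P) : FM P →ₗ[K] FM P :=
  Finsupp.lift (FM P) K {A : Mat // A ∈ P} fun A => f A.1

/-- The set `Ξ^j_{m|n,d}`: matrices supported on `{-m,…,m} × {-n,…,n}`, centro-symmetric,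
with total entry sum `2d+1`.  (Note `𝕀_{2m+1} = {-m,…,m}`.) -/
def Xij (m n d : ℕ) : Set Mat :=
  {A | (∀ i j, A i j ≠ 0 → i ∈ II (2*m+1) ∧ j ∈ II (2*n+1)) ∧
       (∀ i j, A i j = A (-i) (-j)) ∧
       ∑ i ∈ II (2*m+1), ∑ j ∈ II (2*n+1), A i j = 2*d+1}

/-- Left operator `B^L_i` (j-case), for half-integers `i ∈ {1/2,…,m-1/2}`. -/
def BLj (n : ℕ) (P : Set Mat) (i : ℚ) : FM P →ₗ[K] FM P :=
  opOf fun A =>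
    (∑ j ∈ (II (2*n+1)).filter (fun j => j ≤ 0),
      if (if i = 1/2 ∧ j = 0 then 1 else 0) < A (i-1/2) j then
        (q ^ ((∑ k ∈ (II (2*n+1)).filter (fun k => j ≤ k), ((A (i+1/2) k : ℤ) - (A (i-1/2) k : ℤ)))
              + 1 + (if i = 1/2 then 1 else 0))
          * qint ((A (i-1/2) j : ℤ) - (if i = 1/2 ∧ j = 0 then 1 else 0)))
          • tP P (matMove A (i+1/2) j (i-1/2) j)
      else 0)
    + (∑ j ∈ (II (2*n+1)).filter (fun j => 0 < j),
        (q ^ ((∑ k ∈ (II (2*n+1)).filter (fun k => j ≤ k), ((A (i+1/2) k : ℤ) - (A (i-1/2) k : ℤ))) + 1)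
          * qint (A (i-1/2) j)) • tP P (matMove A (i+1/2) j (i-1/2) j))

/-- Left operator `B^L_{-i}` (j-case), for half-integers `i ∈ {1/2,…,m-1/2}`. -/
def BLjn (n : ℕ) (P : Set Mat) (i : ℚ) : FM P →ₗ[K] FM P :=
  opOf fun A => ∑ j ∈ II (2*n+1),
    (q ^ ((∑ k ∈ (II (2*n+1)).filter (fun k => k ≤ j), ((A (i-1/2) k : ℤ) - (A (i+1/2) k : ℤ))) + 1)
      * qint (A (i+1/2) j)) • tP P (matMove A (i-1/2) j (i+1/2) j)

/-- Left Cartan operator `(d^L_0)^e`, `e = ±1` (j-case). -/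
def dL0j (n : ℕ) (P : Set Mat) (e : ℤ) : FM P →ₗ[K] FM P :=
  opOf fun A => (q ^ (e * (((∑ j ∈ II (2*n+1), (A 0 j : ℤ)) - 1) / 2))) • tP P A

/-- Left Cartan operator `(d^L_r)^e`, `r ∈ {1,…,m}`, `e = ±1` (j-case). -/
def dLj (n : ℕ) (P : Set Mat) (r : ℚ) (e : ℤ) : FM P →ₗ[K] FM P :=
  opOf fun A => (q ^ (e * ∑ j ∈ II (2*n+1), (A r j : ℤ))) • tP P A

/-- Right operator `B^R_i` (j-case), for half-integers `i ∈ {1/2,…,n-1/2}`. -/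
def BRj (m : ℕ) (P : Set Mat) (i : ℚ) : FM P →ₗ[K] FM P :=
  opOf fun A => ∑ j ∈ II (2*m+1),
    (q ^ (∑ k ∈ (II (2*m+1)).filter (fun k => j < k), ((A k (i+1/2) : ℤ) - (A k (i-1/2) : ℤ)))
      * qint (A j (i+1/2))) • tP P (matMove A j (i-1/2) j (i+1/2))

/-- Right operator `B^R_{-i}` (j-case), for half-integers `i ∈ {1/2,…,n-1/2}`. -/
def BRjn (m : ℕ) (P : Set Mat) (i : ℚ) : FM P →ₗ[K] FM P :=
  opOf fun A =>
    (∑ j ∈ (II (2*m+1)).filter (fun j => j ≤ 0),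
      if (if i = 1/2 ∧ j = 0 then 1 else 0) < A j (i-1/2) then
        (q ^ (∑ k ∈ (II (2*m+1)).filter (fun k => k < j), ((A k (i-1/2) : ℤ) - (A k (i+1/2) : ℤ)))
          * qint ((A j (i-1/2) : ℤ) - (if i = 1/2 ∧ j = 0 then 1 else 0)))
          • tP P (matMove A j (i+1/2) j (i-1/2))
      else 0)
    + (∑ j ∈ (II (2*m+1)).filter (fun j => 0 < j),
        (q ^ ((∑ k ∈ (II (2*m+1)).filter (fun k => k < j), ((A k (i-1/2) : ℤ) - (A k (i+1/2) : ℤ)))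
              - (if i = 1/2 then 1 else 0))
          * qint (A j (i-1/2))) • tP P (matMove A j (i+1/2) j (i-1/2)))

/-- Right Cartan operator `(d^R_r)^e`, `r ∈ {1,…,n}`, `e = ±1` (j-case). -/
def dRj (m : ℕ) (P : Set Mat) (r : ℚ) (e : ℤ) : FM P →ₗ[K] FM P :=
  opOf fun A => (q ^ (e * ∑ k ∈ II (2*m+1), (A k r : ℤ))) • tP P A

/-- Right Cartan operator `(d^R_0)^e`, `e = ±1` (j-case). -/
def dR0j (m : ℕ) (P : Set Mat) (e : ℤ) : FM P →ₗ[K] FM P :=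
  opOf fun A => (q ^ (e * (((∑ k ∈ II (2*m+1), (A k 0 : ℤ)) - 1) / 2))) • tP P A

/-- Basis index of `V`: elements of `𝕀_M`. -/
def SubI (M : ℕ) : Type := {a : ℚ // a ∈ II M}

/-- `V^{⊗n}`: free `ℚ(q)`-vector space on `n`-tuples from `𝕀_M`. -/
abbrev TV (n M : ℕ) : Type := (Fin n → SubI M) →₀ K

/-- Basis vector `v_λ`. -/
def tT {n M : ℕ} (l : Fin n → SubI M) : TV n M := Finsupp.single l 1

/-- A "single-target" operator on `V`: `v_a ↦ c a • v_{t a}`. -/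
structure SOp where
  t : ℚ → ℚ
  c : ℚ → K

def SOp.id' : SOp := ⟨fun a => a, fun _ => 1⟩
/-- Composite `O ∘ P`. -/
def SOp.comp (O P : SOp) : SOp := ⟨fun a => O.t (P.t a), fun a => P.c a * O.c (P.t a)⟩
/-- `E_i v_a = δ(a = i+1/2) v_{a-1}`. -/
def Eop (i : ℚ) : SOp := ⟨fun a => a - 1, fun a => if a = i + 1/2 then 1 else 0⟩
/-- `F_i v_a = δ(a = i-1/2) v_{a+1}`. -/
def Fop (i : ℚ) : SOp := ⟨fun a => a + 1, fun a => if a = i - 1/2 then 1 else 0⟩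
/-- A diagonal operator `v_a ↦ q^{f a} v_a`. -/
def diagOp (f : ℚ → ℤ) : SOp := ⟨fun a => a, fun a => q ^ f a⟩
/-- `K_i^{-1}` (diagonal). -/
def Kinv (i : ℚ) : SOp := diagOp fun a => (if a = i+1/2 then 1 else 0) - (if a = i-1/2 then 1 else 0)
/-- `K_i` (diagonal). -/
def Kpos (i : ℚ) : SOp := diagOp fun a => (if a = i-1/2 then 1 else 0) - (if a = i+1/2 then 1 else 0)
/-- `k_i^{-1} = K_i^{-1} K_{-i}`. -/
def kinv (i : ℚ) : SOp := (Kinv i).comp (Kpos (-i))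
/-- `k_i = K_i K_{-i}^{-1}`. -/
def kpos (i : ℚ) : SOp := (Kpos i).comp (Kinv (-i))
/-- `(D_r D_{-r})^e` (diagonal), `e = ±1`. -/
def DDop (r : ℚ) (e : ℤ) : SOp := diagOp fun a => e * ((if a = r then 1 else 0) + (if a = -r then 1 else 0))
/-- `D_0^e` (diagonal), `e = ±1`. -/
def D0op (e : ℤ) : SOp := diagOp fun a => e * (if a = 0 then 1 else 0)

/-- Tensor product `ops 0 ⊗ ops 1 ⊗ ⋯ ⊗ ops (n-1)` of single-target operators on `V^{⊗n}`. -/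
def tensorOp {n M : ℕ} (ops : Fin n → SOp) : TV n M →ₗ[K] TV n M :=
  Finsupp.lift (TV n M) K (Fin n → SubI M) fun l =>
    if h : ∀ r, (ops r).t (l r).1 ∈ II M then
      Finsupp.single (fun r => ⟨(ops r).t (l r).1, h r⟩) (∏ r, (ops r).c (l r).1)
    else 0

/-- `𝓑_i` on `V^{⊗n}`, for `i ≠ 0` (ı-case) resp. `i ∈ {1/2,…,m-1/2}` (ȷ-case). -/
def calB (n M : ℕ) (i : ℚ) : TV n M →ₗ[K] TV n M :=
  (∑ r : Fin n, tensorOp fun s => if s < r then SOp.id' else if s = r then Fop i else Kinv i)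
  + (∑ r : Fin n, tensorOp fun s => if s < r then kinv i else if s = r then (Eop (-i)).comp (Kinv i) else Kinv i)

/-- `𝓑_0` on `V^{⊗n}` (ı-case). -/
def calB0 (n M : ℕ) : TV n M →ₗ[K] TV n M :=
  (∑ r : Fin n, tensorOp fun s => if s < r then SOp.id' else if s = r then Fop 0 else Kinv 0)
  + q⁻¹ • (∑ r : Fin n, tensorOp fun s => if s < r then SOp.id' else if s = r then (Eop 0).comp (Kinv 0) else Kinv 0)
  + tensorOp fun _ => Kinv 0

/-- `𝓑_{-i}` on `V^{⊗n}` (ȷ-case), for `i ∈ {1/2,…,m-1/2}`. -/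
def calBn (n M : ℕ) (i : ℚ) : TV n M →ₗ[K] TV n M :=
  (∑ r : Fin n, tensorOp fun s => if s < r then SOp.id' else if s = r then Fop (-i) else Kinv (-i))
  + (∑ r : Fin n, tensorOp fun s => if s < r then kpos i else if s = r then (Kinv (-i)).comp (Eop i) else Kinv (-i))

/-- `𝓓_r^e = ((D_r D_{-r})^e)^{⊗n}`. -/
def calD (n M : ℕ) (r : ℚ) (e : ℤ) : TV n M →ₗ[K] TV n M := tensorOp fun _ => DDop r e

/-- `𝓓_0^e = (D_0^e)^{⊗n}`. -/
def calD0 (n M : ℕ) (e : ℤ) : TV n M →ₗ[K] TV n M := tensorOp fun _ => D0op e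

/-- Negation on `𝕀_M`. -/
def negS {M : ℕ} (a : SubI M) : SubI M := ⟨-a.1, II_neg a.2⟩

/-- `λ · s` where `s` interchanges the tensor positions `a` and `b`. -/
def swapL {n M : ℕ} (a b : Fin n) (l : Fin n → SubI M) : Fin n → SubI M := l ∘ Equiv.swap a b

/-- The Hecke operator `σ` acting in tensor positions `a, b` (for `a < b` adjacent). -/
def sigmaI {n M : ℕ} (a b : Fin n) : TV n M →ₗ[K] TV n M :=
  Finsupp.lift (TV n M) K (Fin n → SubI M) fun l =>
    if (l a).1 < (l b).1 then tT (swapL a b l)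
    else if (l a).1 = (l b).1 then q⁻¹ • tT l
    else tT (swapL a b l) + (q⁻¹ - q) • tT l

/-- The Hecke operator `σ_0`. -/
def sigma0 {n M : ℕ} (hn : 0 < n) : TV n M →ₗ[K] TV n M :=
  Finsupp.lift (TV n M) K (Fin n → SubI M) fun l =>
    if 0 < (l ⟨0, hn⟩).1 then tT (Function.update l ⟨0, hn⟩ (negS (l ⟨0, hn⟩)))
    else if (l ⟨0, hn⟩).1 = 0 then q⁻¹ • tT l
    else tT (Function.update l ⟨0, hn⟩ (negS (l ⟨0, hn⟩))) + (q⁻¹ - q) • tT l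

/-- `σ_i`, `0 ≤ i ≤ n-1` (for `i ≥ 1` it acts on the 1-based entries `λ_i, λ_{i+1}`). -/
def sigmaB {n M : ℕ} (hn : 0 < n) (i : ℕ) (hi : i < n) : TV n M →ₗ[K] TV n M :=
  if i = 0 then sigma0 hn else sigmaI ⟨i - 1, by omega⟩ ⟨i, hi⟩

/-- The subset `Ξ^{j,0}_{m|n,n}`. -/
def Xi0j (m n : ℕ) : Set Mat :=
  {A | A ∈ Xij m n n ∧ A 0 0 = 1 ∧
       ∀ j ∈ (II (2*n+1)).filter (fun j => 0 < j), ∑ i ∈ II (2*m+1), A i j = 1}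

/-- The ı-weight `ρ̄` subspace `𝒱^{j,0}_{m|n,n}`. -/
def V0j (m n : ℕ) : Submodule K (FM (Xij m n n)) :=
  Submodule.span K {v | ∃ A ∈ Xi0j m n, v = tP (Xij m n n) A}

/-- The 0-1 matrix `A_λ` (j-case): column `j` is `e_{λ_j}`, column `-j` is `e_{-λ_j}`
(`j = 1,…,n`; here `j : Fin n` is 0-based, so column `j + 1`), and column `0` is `e_0`. -/
def Aj {n : ℕ} (l : Fin n → ℚ) : Mat := fun x y =>
  (if x = 0 ∧ y = 0 then 1 else 0)
  + ∑ j : Fin n, ((if y = (j : ℚ) + 1 ∧ x = l j then 1 else 0)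
                + (if y = -((j : ℚ) + 1) ∧ x = -(l j) then 1 else 0))

/-- The linear map `Λ^j : V^{⊗n} → 𝒱^j_{m|n,n}`, `v_λ ↦ t^{(A_λ)}`. -/
def Lamj (m n : ℕ) : TV n (2*m+1) →ₗ[K] FM (Xij m n n) :=
  Finsupp.lift (FM (Xij m n n)) K (Fin n → SubI (2*m+1)) fun l =>
    tP (Xij m n n) (Aj fun r => (l r).1)

/-- The composite `C_i : x ↦ (x B^R_{i+1/2}) B^R_{-i-1/2}` on `𝒱^ȷ_{m|n,n}`. -/
def Cij (m n : ℕ) (i : ℚ) : Module.End K (FM (Xij m n n)) :=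
  (BRjn m (Xij m n n) (i + 1/2) : Module.End K (FM (Xij m n n))) * BRj m (Xij m n n) (i + 1/2)

/-- The operator `T_i = id - q^{-1} C_i`. -/
def Tij (m n : ℕ) (i : ℚ) : Module.End K (FM (Xij m n n)) := 1 - q⁻¹ • Cij m n i

theorem q_ne_zero : q ≠ 0 := RatFunc.X_ne_zero

theorem q_sub_inv_ne_zero : q - q⁻¹ ≠ 0 := by
  intro h
  have h1 : q * q = 1 := by
    rw [sub_eq_zero] at h
    nth_rewrite 2 [h]
    exact mul_inv_cancel₀ q_ne_zero
  have h2 : (Polynomial.X * Polynomial.X : Polynomial ℚ) = 1 := by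
    apply RatFunc.algebraMap_injective ℚ
    simpa [q] using h1
  have h3 := congrArg (Polynomial.eval 0) h2
  simp at h3

theorem qint_zero : qint 0 = 0 := by simp [qint]

theorem qint_one : qint 1 = 1 := by
  simp [qint, div_self q_sub_inv_ne_zero]

theorem qint_two : qint 2 = q + q⁻¹ := by
  rw [qint, div_eq_iff q_sub_inv_ne_zero, zpow_neg, zpow_ofNat]
  ring

theorem mem_II_iff {N : ℕ} {y : ℚ} :
    y ∈ II (2 * N + 1) ↔ ∃ k : ℕ, k < 2 * N + 1 ∧ (k : ℚ) - N = y := by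
  have h (k : ℕ) : (k : ℚ) - (((2 * N + 1 : ℕ) : ℚ) - 1) / 2 = k - N := by
    push_cast
    ring
  simp only [II, Finset.mem_image, Finset.mem_range, h]

theorem natCast_add_one_mem_II {n : ℕ} (k : Fin n) : (k : ℚ) + 1 ∈ II (2 * n + 1) :=
  mem_II_iff.mpr ⟨k + 1 + n, by omega, by push_cast; ring⟩

theorem zero_mem_II (n : ℕ) : (0 : ℚ) ∈ II (2 * n + 1) :=
  mem_II_iff.mpr ⟨n, by omega, by ring⟩

theorem lift_single_one {X W : Type*} [AddCommGroup W] [Module K W] (f : X → W) (x : X) :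
    Finsupp.lift W K X f (Finsupp.single x 1) = f x := by
  simp

theorem opOf_tP {P : Set Mat} (f : Mat → FM P) {A : Mat} (hA : A ∈ P) :
    opOf f (tP P A) = f A := by
  simp [opOf, tP, hA]

theorem matMove_eq {A A' : Mat} {p j p' j' : ℚ} (h : A + chiM p j = A' + chiM p' j') :
    matMove A p j p' j' = A' := by
  funext x y
  have hxy := congrFun (congrFun h x) y
  simp only [Pi.add_apply] at hxy
  simp only [matMove]
  omega

theorem chiM_apply_of_pos {p c x y : ℚ} (hc : 0 < c) (hy : 0 < y) :
    chiM p c x y = if x = p ∧ y = c then 1 else 0 := by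
  have h : ¬ y = -c := by linarith
  simp [chiM, h]

theorem chiM_neg (p c x y : ℚ) : chiM p c (-x) (-y) = chiM p c x y := by
  simp only [chiM, neg_eq_iff_eq_neg (a := x), neg_eq_iff_eq_neg (a := y), neg_neg]
  ring

theorem sum_chiM {S T : Finset ℚ} {p c : ℚ} (hp : p ∈ S) (hc : c ∈ T) (hp' : -p ∈ S)
    (hc' : -c ∈ T) : ∑ x ∈ S, ∑ y ∈ T, chiM p c x y = 2 := by
  have h {a b : ℚ} (ha : a ∈ S) (hb : b ∈ T) :
      ∑ x ∈ S, ∑ y ∈ T, (if x = a ∧ y = b then 1 else 0) = 1 := by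
    rw [Finset.sum_eq_single_of_mem a ha (fun x _ hx => by simp [hx])]
    simp [hb]
  simp only [chiM, Finset.sum_add_distrib, h hp hc, h hp' hc']

/-- The matrix `E_{0,0} + ∑_{k ∈ s} E^θ_{l_k, c_k}`. -/
def thetaSum {n : ℕ} (s : Finset (Fin n)) (l c : Fin n → ℚ) : Mat := fun x y =>
  (if x = 0 ∧ y = 0 then 1 else 0) + ∑ k ∈ s, chiM (l k) (c k) x y

theorem Aj_eq_thetaSum {n : ℕ} (l : Fin n → ℚ) :
    Aj l = thetaSum Finset.univ l (fun k => (k : ℚ) + 1) := by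
  funext x y
  simp only [Aj, thetaSum, chiM, and_comm]

theorem thetaSum_mem_Xij {m n : ℕ} {l c : Fin n → ℚ} (hl : ∀ k, l k ∈ II (2 * m + 1))
    (hc : ∀ k, c k ∈ II (2 * n + 1)) : thetaSum Finset.univ l c ∈ Xij m n n := by
  refine ⟨fun x y hxy => ?_, fun x y => ?_, ?_⟩
  · by_cases h0 : x = 0 ∧ y = 0
    · rw [h0.1, h0.2]
      exact ⟨zero_mem_II m, zero_mem_II n⟩
    · simp only [thetaSum, h0, if_false, zero_add] at hxy
      obtain ⟨k, -, hk⟩ := Finset.exists_ne_zero_of_sum_ne_zero hxy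
      by_cases h1 : x = l k ∧ y = c k
      · rw [h1.1, h1.2]
        exact ⟨hl k, hc k⟩
      · by_cases h2 : x = -l k ∧ y = -c k
        · rw [h2.1, h2.2]
          exact ⟨II_neg (hl k), II_neg (hc k)⟩
        · simp [chiM, h1, h2] at hk
  · simp only [thetaSum, chiM_neg, neg_eq_zero]
  · simp only [thetaSum, Finset.sum_add_distrib]
    have h0 : ∑ x ∈ II (2 * m + 1), ∑ y ∈ II (2 * n + 1),
        (if x = 0 ∧ y = 0 then 1 else 0) = 1 := by
      rw [Finset.sum_eq_single_of_mem 0 (zero_mem_II m) (fun x _ hx => by simp [hx])]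
      simp [zero_mem_II n]
    rw [h0]
    have h1 : ∑ x ∈ II (2 * m + 1), ∑ y ∈ II (2 * n + 1), ∑ k, chiM (l k) (c k) x y
        = ∑ k, ∑ x ∈ II (2 * m + 1), ∑ y ∈ II (2 * n + 1), chiM (l k) (c k) x y := by
      symm
      rw [Finset.sum_comm]
      exact Finset.sum_congr rfl fun x _ => Finset.sum_comm
    rw [h1, Finset.sum_congr rfl fun k _ =>
      sum_chiM (hl k) (hc k) (II_neg (hl k)) (II_neg (hc k))]
    simp
    ring

theorem Aj_mem_Xij {m n : ℕ} {l : Fin n → ℚ} (hl : ∀ k, l k ∈ II (2 * m + 1)) :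
    Aj l ∈ Xij m n n := by
  rw [Aj_eq_thetaSum]
  exact thetaSum_mem_Xij hl natCast_add_one_mem_II

theorem thetaSum_apply_eq_zero {n : ℕ} {s : Finset (Fin n)} {l c : Fin n → ℚ} {y : ℚ}
    (hy : 0 < y) (hc : ∀ k ∈ s, 0 < c k ∧ y ≠ c k) (x : ℚ) : thetaSum s l c x y = 0 := by
  simp only [thetaSum, hy.ne', and_false, if_false, zero_add]
  refine Finset.sum_eq_zero fun k hk => ?_
  simp [chiM_apply_of_pos (hc k hk).1 hy, (hc k hk).2]

theorem thetaSum_congr {n : ℕ} {s : Finset (Fin n)} {l l' c c' : Fin n → ℚ}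
    (hl : ∀ k ∈ s, l k = l' k) (hc : ∀ k ∈ s, c k = c' k) : thetaSum s l c = thetaSum s l' c' := by
  funext x y
  rw [thetaSum, thetaSum, Finset.sum_congr rfl fun k hk => by rw [hl k hk, hc k hk]]

theorem thetaSum_univ_eq {n : ℕ} {u v : Fin n} (huv : u ≠ v) (l c : Fin n → ℚ) :
    thetaSum Finset.univ l c
      = thetaSum {u, v}ᶜ l c + chiM (l u) (c u) + chiM (l v) (c v) := by
  funext x y
  simp only [thetaSum, Pi.add_apply]
  rw [← Finset.sum_compl_add_sum {u, v}, Finset.sum_pair huv]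
  ring

section Operators

variable {m : ℕ} {P : Set Mat} {i : ℚ} {R : Mat} {a b : ℚ}

theorem BRj_tP_eq_zero {A : Mat} (hA : A ∈ P) (h : ∀ x, A x (i + 1) = 0) :
    BRj m P (i + 1/2) (tP P A) = 0 := by
  have e1 : i + 1/2 + 1/2 = i + 1 := by ring
  rw [BRj, opOf_tP _ hA, e1]
  simp [h, qint_zero]

theorem BRj_tP (hi : 0 < i) (hR : ∀ x, R x i = 0) (hR' : ∀ x, R x (i + 1) = 0)
    (ha : a ∈ II (2 * m + 1)) (hb : b ∈ II (2 * m + 1))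
    (hA : R + chiM a i + chiM b (i + 1) ∈ P) :
    BRj m P (i + 1/2) (tP P (R + chiM a i + chiM b (i + 1)))
      = q ^ (-(if b < a then 1 else 0) : ℤ) • tP P (R + chiM a i + chiM b i) := by
  have e1 : i + 1/2 + 1/2 = i + 1 := by ring
  have e2 : i + 1/2 - 1/2 = i := by ring
  have hi' : 0 < i + 1 := by linarith
  have c1 (x : ℚ) : (R + chiM a i + chiM b (i + 1)) x (i + 1) = if x = b then 1 else 0 := by
    simp [hR', chiM_apply_of_pos, hi, hi']
  have c2 (x : ℚ) : (R + chiM a i + chiM b (i + 1)) x i = if x = a then 1 else 0 := by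
    simp [hR, chiM_apply_of_pos, hi, hi']
  rw [BRj, opOf_tP _ hA, e1, e2, Finset.sum_eq_single_of_mem b hb]
  · rw [matMove_eq (A' := R + chiM a i + chiM b i) (by ac_rfl)]
    simp only [c1, c2]
    simp [qint_one, Finset.sum_sub_distrib, Finset.sum_ite_eq', ha]
  · intro x _ hx
    rw [c1]
    simp [hx, qint_zero]

theorem BRjn_tP_eq_sum {A : Mat} (hi : 0 < i) (hA : A ∈ P) :
    BRjn m P (i + 1/2) (tP P A) = ∑ j ∈ II (2 * m + 1),
      (q ^ (∑ k ∈ (II (2 * m + 1)).filter (fun k => k < j), ((A k i : ℤ) - (A k (i + 1) : ℤ)))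
        * qint (A j i)) • tP P (matMove A j (i + 1) j i) := by
  have e1 : i + 1/2 + 1/2 = i + 1 := by ring
  have e2 : i + 1/2 - 1/2 = i := by ring
  have e3 : ¬ i + 1/2 = 1/2 := by linarith
  rw [BRjn, opOf_tP _ hA, e1, e2,
    ← Finset.sum_filter_add_sum_filter_not (II (2 * m + 1)) (fun j => j ≤ 0)]
  simp only [e3, false_and, if_false, not_le, sub_zero]
  congr 1
  refine Finset.sum_congr rfl fun j _ => ?_
  split_ifs with h
  · rfl
  · simp [Nat.eq_zero_of_not_pos h, qint_zero]

theorem BRjn_tP_of_eq (hi : 0 < i) (hR : ∀ x, R x i = 0) (hR' : ∀ x, R x (i + 1) = 0)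
    (ha : a ∈ II (2 * m + 1)) (hA : R + chiM a i + chiM a i ∈ P) :
    BRjn m P (i + 1/2) (tP P (R + chiM a i + chiM a i))
      = (q + q⁻¹) • tP P (R + chiM a i + chiM a (i + 1)) := by
  have hi' : 0 < i + 1 := by linarith
  have c1 (x : ℚ) : (R + chiM a i + chiM a i) x (i + 1) = 0 := by
    simp [hR', chiM_apply_of_pos, hi, hi']
  have c2 (x : ℚ) : (R + chiM a i + chiM a i) x i = if x = a then 2 else 0 := by
    simp only [Pi.add_apply, hR, chiM_apply_of_pos hi hi]
    split_ifs <;> simp_all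
  rw [BRjn_tP_eq_sum hi hA, Finset.sum_eq_single_of_mem a ha]
  · rw [matMove_eq (A' := R + chiM a i + chiM a (i + 1)) (by ac_rfl)]
    simp only [c1, c2]
    simp [qint_two]
  · intro x _ hx
    rw [c2]
    simp [hx, qint_zero]

theorem BRjn_tP_of_ne (hi : 0 < i) (hR : ∀ x, R x i = 0) (hR' : ∀ x, R x (i + 1) = 0)
    (ha : a ∈ II (2 * m + 1)) (hb : b ∈ II (2 * m + 1)) (hab : a ≠ b)
    (hA : R + chiM a i + chiM b i ∈ P) :
    BRjn m P (i + 1/2) (tP P (R + chiM a i + chiM b i))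
      = q ^ (if b < a then 1 else 0 : ℤ) • tP P (R + chiM b i + chiM a (i + 1))
        + q ^ (if a < b then 1 else 0 : ℤ) • tP P (R + chiM a i + chiM b (i + 1)) := by
  have hi' : 0 < i + 1 := by linarith
  have c1 (x : ℚ) : (R + chiM a i + chiM b i) x (i + 1) = 0 := by
    simp [hR', chiM_apply_of_pos, hi, hi']
  have c2 (x : ℚ) : (R + chiM a i + chiM b i) x i
      = (if x = a then 1 else 0) + (if x = b then 1 else 0) := by
    simp [hR, chiM_apply_of_pos hi hi]
  rw [BRjn_tP_eq_sum hi hA, Finset.sum_eq_add_of_mem a b ha hb hab]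
  · rw [matMove_eq (A' := R + chiM b i + chiM a (i + 1)) (by ac_rfl),
      matMove_eq (A' := R + chiM a i + chiM b (i + 1)) (by ac_rfl)]
    simp only [c1, c2]
    simp [qint_one, Finset.sum_add_distrib, Finset.sum_ite_eq', ha, hb, hab, hab.symm]
  · intro x _ hx
    rw [c2]
    simp [hx, qint_zero]

end Operators

theorem Lamj_tT {m n : ℕ} (l : Fin n → SubI (2 * m + 1)) :
    Lamj m n (tT l) = tP (Xij m n n) (Aj fun r => (l r).1) := by
  simp [Lamj, tT]

theorem sigmaI_tT {n M : ℕ} (a b : Fin n) (l : Fin n → SubI M) :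
    sigmaI a b (tT l) = if (l a).1 < (l b).1 then tT (swapL a b l)
      else if (l a).1 = (l b).1 then q⁻¹ • tT l
      else tT (swapL a b l) + (q⁻¹ - q) • tT l := by
  exact lift_single_one _ l

theorem Aj_apply_natCast_add_one {n : ℕ} (l : Fin n → ℚ) (x : ℚ) (k : Fin n) :
    Aj l x ((k : ℚ) + 1) = if x = l k then 1 else 0 := by
  have hk : (0 : ℚ) < (k : ℚ) + 1 := by positivity
  have h (j : Fin n) : (0 : ℚ) < (j : ℚ) + 1 := by positivity
  rw [Aj_eq_thetaSum, thetaSum]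
  simp only [chiM_apply_of_pos (h _) hk, hk.ne', and_false, if_false, zero_add]
  rw [Finset.sum_eq_single k]
  · simp
  · intro j _ hj
    have : ¬ (k : ℚ) = j := by
      exact_mod_cast fun e : (k : ℕ) = j => hj (Fin.ext e.symm)
    simp [this]
  · simp

theorem Aj_apply_zero {n : ℕ} (l : Fin n → ℚ) (x : ℚ) :
    Aj l x 0 = if x = 0 then 1 else 0 := by
  have h (j : Fin n) : (0 : ℚ) < (j : ℚ) + 1 := by positivity
  have h1 (j : Fin n) : ¬ (0 : ℚ) = (j : ℚ) + 1 := (h j).ne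
  have h2 (j : Fin n) : ¬ (0 : ℚ) = -((j : ℚ) + 1) := (neg_lt_zero.mpr (h j)).ne'
  simp only [Aj, h1, h2, and_true, false_and, if_false, add_zero, Finset.sum_const_zero]

theorem Aj_mem_Xi0j {m n : ℕ} {l : Fin n → ℚ} (hl : ∀ k, l k ∈ II (2 * m + 1)) :
    Aj l ∈ Xi0j m n := by
  refine ⟨Aj_mem_Xij hl, ?_, fun y hy => ?_⟩
  · simp [Aj_apply_zero]
  · rw [Finset.mem_filter, mem_II_iff] at hy
    obtain ⟨⟨k, hk, rfl⟩, hpos⟩ := hy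
    have hnk : n < k := by exact_mod_cast sub_pos.mp hpos
    have e : (k : ℚ) - n = ((⟨k - n - 1, by omega⟩ : Fin n) : ℚ) + 1 := by
      have : k = (k - n - 1) + 1 + n := by omega
      rw [sub_eq_iff_eq_add]
      exact_mod_cast this
    rw [e, Finset.sum_congr rfl fun x _ => Aj_apply_natCast_add_one l x _]
    simp [hl]

theorem exists_eq_Aj {m n : ℕ} {A : Mat} (hA : A ∈ Xi0j m n) :
    ∃ l : Fin n → SubI (2 * m + 1), A = Aj fun r => (l r).1 := by
  obtain ⟨⟨hsupp, hsymm, hsum⟩, h00, hcol⟩ := hA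
  have hex (k : Fin n) : ∃ x ∈ II (2 * m + 1), A x ((k : ℚ) + 1) ≠ 0 := by
    refine Finset.exists_ne_zero_of_sum_ne_zero ?_
    rw [hcol _ (Finset.mem_filter.mpr ⟨natCast_add_one_mem_II k, by positivity⟩)]
    exact one_ne_zero
  choose l hl hne using hex
  have hmem : Aj l ∈ Xij m n n := Aj_mem_Xij hl
  have hpos (x : ℚ) (k : Fin n) : Aj l x ((k : ℚ) + 1) ≤ A x ((k : ℚ) + 1) := by
    rw [Aj_apply_natCast_add_one]
    split_ifs with h
    · rw [h]
      exact Nat.pos_of_ne_zero (hne k)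
    · exact Nat.zero_le _
  have hle (x y : ℚ) : Aj l x y ≤ A x y := by
    by_cases h0 : y = 0
    · rw [h0, Aj_apply_zero]
      split_ifs with hx
      · rw [hx, h00]
      · exact Nat.zero_le _
    · by_cases hp : ∃ k : Fin n, y = (k : ℚ) + 1
      · obtain ⟨k, rfl⟩ := hp
        exact hpos x k
      · by_cases hn : ∃ k : Fin n, y = -((k : ℚ) + 1)
        · obtain ⟨k, rfl⟩ := hn
          have h1 := hpos (-x) k
          rw [hmem.2.1, hsymm, neg_neg] at h1
          exact h1
        · push Not at hp hn
          simp only [Aj, h0, hp, hn, and_false, false_and, if_false, add_zero,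
            Finset.sum_const_zero, zero_le]
  have heq : ∀ x ∈ II (2 * m + 1), ∀ y ∈ II (2 * n + 1), Aj l x y = A x y := by
    intro x hx
    rw [← Finset.sum_eq_sum_iff_of_le fun y _ => hle x y]
    revert x
    rw [← Finset.sum_eq_sum_iff_of_le fun x _ => Finset.sum_le_sum fun y _ => hle x y]
    rw [hmem.2.2, hsum]
  refine ⟨fun k => ⟨l k, hl k⟩, funext fun x => funext fun y => ?_⟩
  by_cases h : A x y = 0
  · rw [h]
    exact (Nat.le_zero.mp (h ▸ hle x y)).symm
  · exact (heq x (hsupp x y h).1 y (hsupp x y h).2).symm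

theorem V0j_eq_span_range (m n : ℕ) :
    V0j m n = Submodule.span K (Set.range fun l : Fin n → SubI (2 * m + 1) => Lamj m n (tT l)) := by
  rw [V0j]
  congr 1
  ext v
  constructor
  · rintro ⟨A, hA, rfl⟩
    obtain ⟨l, rfl⟩ := exists_eq_Aj hA
    exact ⟨l, Lamj_tT l⟩
  · rintro ⟨l, rfl⟩
    exact ⟨_, Aj_mem_Xi0j fun k => (l k).2, Lamj_tT l⟩

theorem exists_Aj_eq_add {m n i : ℕ} {l : Fin n → ℚ} (hl : ∀ k, l k ∈ II (2 * m + 1))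
    {u v : Fin n} (hu : (u : ℕ) + 1 = i) (hv : (v : ℕ) = i) :
    ∃ R : Mat, (∀ x, R x (i : ℚ) = 0) ∧ (∀ x, R x ((i : ℚ) + 1) = 0) ∧
      Aj l = R + chiM (l u) i + chiM (l v) ((i : ℚ) + 1) ∧
      Aj (l ∘ Equiv.swap u v) = R + chiM (l v) i + chiM (l u) ((i : ℚ) + 1) ∧
      R + chiM (l u) i + chiM (l v) i ∈ Xij m n n := by
  have huv : u ≠ v := fun h => by
    rw [h] at hu
    omega
  have hcu : ((u : ℕ) : ℚ) + 1 = i := by exact_mod_cast hu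
  have hcv : ((v : ℕ) : ℚ) = i := by exact_mod_cast hv
  have hi : (0 : ℚ) < i := by
    rw [← hcu]
    positivity
  refine ⟨thetaSum {u, v}ᶜ l (fun k => (k : ℚ) + 1), thetaSum_apply_eq_zero hi ?_,
    thetaSum_apply_eq_zero (by linarith) ?_, ?_, ?_, ?_⟩
  · intro k hk
    refine ⟨by positivity, fun h => ?_⟩
    rw [← hcu] at h
    have hk' : k = u := Fin.ext (by exact_mod_cast (add_right_cancel h).symm)
    simp [hk'] at hk
  · intro k hk
    refine ⟨by positivity, fun h => ?_⟩
    rw [← hcv] at h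
    have hk' : k = v := Fin.ext (by exact_mod_cast (add_right_cancel h).symm)
    simp [hk'] at hk
  · rw [Aj_eq_thetaSum, thetaSum_univ_eq huv, hcu, hcv]
  · rw [Aj_eq_thetaSum, thetaSum_univ_eq huv, hcu, hcv]
    simp only [Function.comp_apply, Equiv.swap_apply_left, Equiv.swap_apply_right]
    congr 2
    refine thetaSum_congr (fun k hk => ?_) fun _ _ => rfl
    simp only [Finset.mem_compl, Finset.mem_insert, Finset.mem_singleton, not_or] at hk
    rw [Function.comp_apply, Equiv.swap_apply_of_ne_of_ne hk.1 hk.2]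
  · have hiI : (i : ℚ) ∈ II (2 * n + 1) := hcu ▸ natCast_add_one_mem_II u
    have h := thetaSum_mem_Xij (m := m) (l := l)
      (c := Function.update (fun k : Fin n => (k : ℚ) + 1) v i) hl fun k => by
        rcases eq_or_ne k v with rfl | hk
        · rwa [Function.update_self]
        · rw [Function.update_of_ne hk]
          exact natCast_add_one_mem_II k
    rw [thetaSum_univ_eq huv, Function.update_self, Function.update_of_ne huv, hcu] at h
    convert h using 3
    refine thetaSum_congr (fun _ _ => rfl) fun k hk => ?_
    simp only [Finset.mem_compl, Finset.mem_insert, Finset.mem_singleton, not_or] at hk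
    rw [Function.update_of_ne hk.2]

theorem BRj_BRj_tP_Aj {m n i : ℕ} {l : Fin n → ℚ} (hl : ∀ k, l k ∈ II (2 * m + 1))
    (hi1 : 1 ≤ i) (hi2 : i < n) :
    BRj m (Xij m n n) ((i : ℚ) + 1/2) (BRj m (Xij m n n) ((i : ℚ) + 1/2)
      (tP (Xij m n n) (Aj l))) = 0 := by
  obtain ⟨R, hR, hR', hA, -, hB⟩ := exists_Aj_eq_add hl
    (u := ⟨i - 1, by omega⟩) (v := ⟨i, hi2⟩) (Nat.sub_add_cancel hi1) rfl
  have hi : (0 : ℚ) < i := by exact_mod_cast hi1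
  have hi' : (0 : ℚ) < (i : ℚ) + 1 := by linarith
  rw [hA, BRj_tP hi hR hR' (hl _) (hl _) (hA ▸ Aj_mem_Xij hl), map_smul, BRj_tP_eq_zero hB,
    smul_zero]
  intro x
  simp [hR', chiM_apply_of_pos hi hi']

theorem quadratic_relation_of_apply_apply {F W : Type*} [Field F] [AddCommGroup W] [Module F W]
    {a : F} (ha : a ≠ 0) {C : Module.End F W} {x : W} (h : C (C x) = (a + a⁻¹) • C x) :
    ((1 - a⁻¹ • C + a ^ (-2 : ℤ) • 1) * (1 - a⁻¹ • C - 1)) x = 0 := by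
  have e : a ^ (-2 : ℤ) = a⁻¹ * a⁻¹ := by
    rw [zpow_neg, zpow_ofNat, pow_two, mul_inv]
  simp only [e, Module.End.mul_apply, LinearMap.add_apply, LinearMap.sub_apply,
    LinearMap.smul_apply, Module.End.one_apply, map_sub, map_smul, h]
  match_scalars <;> field_simp <;> ring

section Composite

variable {m n i : ℕ} {l : Fin n → SubI (2 * m + 1)} {u v : Fin n}

theorem Cij_Lamj_of_eq (hu : (u : ℕ) + 1 = i) (hv : (v : ℕ) = i) (h : (l u).1 = (l v).1) :
    Cij m n i (Lamj m n (tT l)) = (q + q⁻¹) • Lamj m n (tT l) := by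
  have hl (k : Fin n) := (l k).2
  obtain ⟨R, hR, hR', hA, -, hB⟩ := exists_Aj_eq_add hl hu hv
  have hi : (0 : ℚ) < i := by exact_mod_cast (by omega : 0 < i)
  rw [h] at hA hB
  rw [Lamj_tT, Cij, Module.End.mul_apply, hA,
    BRj_tP hi hR hR' (hl v) (hl v) (hA ▸ Aj_mem_Xij hl), map_smul,
    BRjn_tP_of_eq hi hR hR' (hl v) hB]
  simp

theorem Cij_Lamj_of_ne (hu : (u : ℕ) + 1 = i) (hv : (v : ℕ) = i) (h : (l u).1 ≠ (l v).1) :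
    Cij m n i (Lamj m n (tT l)) = Lamj m n (tT (swapL u v l))
      + (if (l u).1 < (l v).1 then q else q⁻¹) • Lamj m n (tT l) := by
  have hl (k : Fin n) := (l k).2
  obtain ⟨R, hR, hR', hA, hA', hB⟩ := exists_Aj_eq_add hl hu hv
  have hi : (0 : ℚ) < i := by exact_mod_cast (by omega : 0 < i)
  have hs : (fun r => (swapL u v l r).1) = (fun r => (l r).1) ∘ Equiv.swap u v := rfl
  rw [Lamj_tT, Lamj_tT, hs, hA', Cij, Module.End.mul_apply, hA,
    BRj_tP hi hR hR' (hl u) (hl v) (hA ▸ Aj_mem_Xij hl), map_smul,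
    BRjn_tP_of_ne hi hR hR' (hl u) (hl v) h hB]
  rcases lt_or_gt_of_ne h with h | h
  · simp [h, h.not_gt]
  · simp [h, h.not_gt, smul_smul, q_ne_zero]

theorem neg_q_smul_Tij_Lamj (hu : (u : ℕ) + 1 = i) (hv : (v : ℕ) = i) :
    (-q) • Tij m n i (Lamj m n (tT l)) = Lamj m n (sigmaI u v (tT l)) := by
  have hT (x : FM (Xij m n n)) : (-q) • Tij m n i x = Cij m n i x - q • x := by
    rw [Tij, LinearMap.sub_apply, LinearMap.smul_apply, Module.End.one_apply, smul_sub, smul_smul,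
      neg_mul, mul_inv_cancel₀ q_ne_zero, neg_smul, neg_smul, one_smul]
    abel
  rw [hT, sigmaI_tT]
  rcases lt_trichotomy (l u).1 (l v).1 with h | h | h
  · rw [Cij_Lamj_of_ne hu hv h.ne, if_pos h, if_pos h, add_sub_cancel_right]
  · rw [Cij_Lamj_of_eq hu hv h, if_neg h.not_lt, if_pos h, map_smul, ← sub_smul, add_sub_cancel_left]
  · rw [Cij_Lamj_of_ne hu hv h.ne', if_neg h.not_gt, if_neg h.not_gt, if_neg h.ne', map_add,
      map_smul, sub_smul, add_sub_assoc]

theorem Cij_Cij_Lamj (hu : (u : ℕ) + 1 = i) (hv : (v : ℕ) = i) :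
    Cij m n i (Cij m n i (Lamj m n (tT l))) = (q + q⁻¹) • Cij m n i (Lamj m n (tT l)) := by
  by_cases h : (l u).1 = (l v).1
  · rw [Cij_Lamj_of_eq hu hv h, map_smul, Cij_Lamj_of_eq hu hv h]
  · have hsu : (swapL u v l u).1 = (l v).1 := by simp [swapL]
    have hsv : (swapL u v l v).1 = (l u).1 := by simp [swapL]
    have hss : swapL u v (swapL u v l) = l := by
      funext k
      simp [swapL]
    have h' : (swapL u v l u).1 ≠ (swapL u v l v).1 := by
      rw [hsu, hsv]
      exact Ne.symm h
    rw [Cij_Lamj_of_ne hu hv h, map_add, map_smul, Cij_Lamj_of_ne hu hv h,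
      Cij_Lamj_of_ne hu hv h', hsu, hsv, hss]
    rcases lt_or_gt_of_ne h with h | h <;>
    · simp only [h, h.not_gt, if_true, if_false, smul_add, add_smul, smul_smul, add_mul,
        inv_mul_cancel₀ q_ne_zero, mul_inv_cancel₀ q_ne_zero, one_smul]
      abel

theorem Cij_mem_V0j {x : FM (Xij m n n)} (hi1 : 1 ≤ i) (hi2 : i < n) (hx : x ∈ V0j m n) :
    Cij m n i x ∈ V0j m n := by
  have hbasis (l : Fin n → SubI (2 * m + 1)) : Lamj m n (tT l) ∈ V0j m n := by
    rw [V0j_eq_span_range]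
    exact Submodule.subset_span ⟨l, rfl⟩
  rw [V0j_eq_span_range] at hx
  induction hx using Submodule.span_induction with
  | mem x hx =>
    obtain ⟨l, rfl⟩ := hx
    have hu : ((⟨i - 1, by omega⟩ : Fin n) : ℕ) + 1 = i := Nat.sub_add_cancel hi1
    have hv : ((⟨i, hi2⟩ : Fin n) : ℕ) = i := rfl
    by_cases h : (l ⟨i - 1, by omega⟩).1 = (l ⟨i, hi2⟩).1
    · simp only [Cij_Lamj_of_eq hu hv h]
      exact Submodule.smul_mem _ _ (hbasis l)
    · simp only [Cij_Lamj_of_ne hu hv h]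
      exact Submodule.add_mem _ (hbasis _) (Submodule.smul_mem _ _ (hbasis l))
  | zero =>
    rw [map_zero]
    exact Submodule.zero_mem _
  | add x y _ _ ihx ihy =>
    rw [map_add]
    exact Submodule.add_mem _ ihx ihy
  | smul c x _ ih =>
    rw [map_smul]
    exact Submodule.smul_mem _ _ ih

theorem Tij_quadratic_relation {x : FM (Xij m n n)} (hi1 : 1 ≤ i) (hi2 : i < n)
    (hx : x ∈ V0j m n) :
    ((Tij m n i + (q ^ (-2 : ℤ)) • 1) * (Tij m n i - 1)) x = 0 := by
  rw [V0j_eq_span_range] at hx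
  induction hx using Submodule.span_induction with
  | mem x hx =>
    obtain ⟨l, rfl⟩ := hx
    exact quadratic_relation_of_apply_apply q_ne_zero <|
      Cij_Cij_Lamj (u := ⟨i - 1, by omega⟩) (v := ⟨i, hi2⟩) (Nat.sub_add_cancel hi1) rfl
  | zero => exact map_zero _
  | add x y _ _ ihx ihy => rw [map_add, ihx, ihy, add_zero]
  | smul c x _ ih => rw [map_smul, ih, smul_zero]

end Composite

theorem stmt6 (m n : ℕ) (hm : 1 ≤ m) (hn : 2 ≤ n) (i : ℕ) (hi1 : 1 ≤ i) (hi2 : i ≤ n - 1) :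
    -- (1) t^{(A)} B^R_{i+1/2} B^R_{i+1/2} = 0 for A ∈ Ξ^{ȷ,0}
    (∀ A : {A : Mat // A ∈ Xij m n n}, A.1 ∈ Xi0j m n →
        BRj m (Xij m n n) ((i : ℚ) + 1/2)
          (BRj m (Xij m n n) ((i : ℚ) + 1/2) (Finsupp.single A 1)) = 0) ∧
    -- (2) C_i preserves 𝒱^{ȷ,0}, with explicit formulas on the basis
    (∀ v ∈ V0j m n, Cij m n (i : ℚ) v ∈ V0j m n) ∧
    (∀ l : Fin n → SubI (2*m+1),
        ((l ⟨i-1, by omega⟩).1 < (l ⟨i, by omega⟩).1 →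
          Cij m n (i : ℚ) (Lamj m n (tT l))
            = Lamj m n (tT (swapL ⟨i-1, by omega⟩ ⟨i, by omega⟩ l)) + q • Lamj m n (tT l))
      ∧ ((l ⟨i-1, by omega⟩).1 = (l ⟨i, by omega⟩).1 →
          Cij m n (i : ℚ) (Lamj m n (tT l)) = (q + q⁻¹) • Lamj m n (tT l))
      ∧ ((l ⟨i, by omega⟩).1 < (l ⟨i-1, by omega⟩).1 →
          Cij m n (i : ℚ) (Lamj m n (tT l))
            = Lamj m n (tT (swapL ⟨i-1, by omega⟩ ⟨i, by omega⟩ l)) + q⁻¹ • Lamj m n (tT l))) ∧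
    -- (3) -q·T_i corresponds to σ_i under Λ^ȷ, and the Hecke relation holds on 𝒱^{ȷ,0}
    (∀ l : Fin n → SubI (2*m+1),
        (-q) • Tij m n (i : ℚ) (Lamj m n (tT l))
          = Lamj m n (sigmaI ⟨i-1, by omega⟩ ⟨i, by omega⟩ (tT l))) ∧
    (∀ v ∈ V0j m n, ((Tij m n (i : ℚ) + (q ^ (-2 : ℤ)) • 1) * (Tij m n (i : ℚ) - 1)) v = 0) := by
  have hin : i < n := by omega
  refine ⟨fun A hA => ?_, fun v hv => Cij_mem_V0j hi1 hin hv, fun l => ⟨fun h => ?_, fun h => ?_,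
    fun h => ?_⟩, fun l => neg_q_smul_Tij_Lamj (Nat.sub_add_cancel hi1) rfl,
    fun v hv => Tij_quadratic_relation hi1 hin hv⟩
  · obtain ⟨l, hl⟩ := exists_eq_Aj hA
    have hs : Finsupp.single A 1 = tP (Xij m n n) (Aj fun r => (l r).1) := by
      rw [← hl, tP, dif_pos A.2]
    rw [hs]
    exact BRj_BRj_tP_Aj (fun k => (l k).2) hi1 hin
  · rw [Cij_Lamj_of_ne (Nat.sub_add_cancel hi1) rfl h.ne, if_pos h]
  · exact Cij_Lamj_of_eq (Nat.sub_add_cancel hi1) rfl h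
  · rw [Cij_Lamj_of_ne (Nat.sub_add_cancel hi1) rfl h.ne', if_neg h.not_gt]

end
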